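/- Let f : ℝⁿ → ℝ, g : ℝⁿ → ℝᵐ and h : ℝⁿ → ℝᵖ be twice continuously differentiable, and let x* ∈ Ω be a local minimizer of f over Ω at which the relaxed constant rank constraint qualification (RCRCQ) holds. Then for every Lagrange multiplier vector (μ, λ) ∈ ℝ₊ᵐ × ℝᵖ satisfying the KKT conditions at x*, and for every direction d in the strong critical cone C^S(x*), one has dᵀ ∇²ₓₓ ℓ(x*, μ, λ) d ≥ 0, where ∇²ₓₓ ℓ(x*, μ, λ) = ∇²f(x*) + Σᵢ μᵢ ∇²gᵢ(x*) + Σⱼ λⱼ ∇²hⱼ(x*) is the Hessian of the Lagrangian with respect to x. That is, the strong second-order necessary condition (SSONC) holds at x*. -/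

import Mathlib

open Filter Topology Set

/-- The feasible set `Ω = {x : g(x) ≤ 0, h(x) = 0}` (componentwise). -/
def feasibleSet {n m p : ℕ} (g : (Fin n → ℝ) → Fin m → ℝ)
    (h : (Fin n → ℝ) → Fin p → ℝ) : Set (Fin n → ℝ) :=
  {x | (∀ i, g x i ≤ 0) ∧ ∀ j, h x j = 0}

/-- The relaxed constant rank constraint qualification (RCRCQ) at `xbar`. -/
def RCRCQ {n m p : ℕ} (g : (Fin n → ℝ) → Fin m → ℝ)
    (h : (Fin n → ℝ) → Fin p → ℝ) (xbar : Fin n → ℝ) : Prop :=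
  ∀ I : Set (Fin m), I ⊆ {i | g xbar i = 0} →
    ∃ r : ℕ, ∀ᶠ x in 𝓝 xbar,
      Module.finrank ℝ (Submodule.span ℝ
        ((fun i => fderiv ℝ (fun y => g y i) x) '' I ∪
          Set.range (fun j => fderiv ℝ (fun y => h y j) x))) = r

/-- The linearized cone `L(xbar)`. -/
def linCone {n m p : ℕ} (g : (Fin n → ℝ) → Fin m → ℝ)
    (h : (Fin n → ℝ) → Fin p → ℝ) (xbar : Fin n → ℝ) : Set (Fin n → ℝ) :=
  {d | (∀ i, g xbar i = 0 → fderiv ℝ (fun y => g y i) xbar d ≤ 0) ∧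
    ∀ j, fderiv ℝ (fun y => h y j) xbar d = 0}

/-- The KKT conditions at `xbar` with multipliers `(μ, lam)`:
stationarity of the Lagrangian, nonnegativity `μ ≥ 0` and complementarity `μᵀg(xbar) = 0`. -/
def KKT {n m p : ℕ} (f : (Fin n → ℝ) → ℝ) (g : (Fin n → ℝ) → Fin m → ℝ)
    (h : (Fin n → ℝ) → Fin p → ℝ) (xbar : Fin n → ℝ)
    (μ : Fin m → ℝ) (lam : Fin p → ℝ) : Prop :=
  (fderiv ℝ f xbar + ∑ i, μ i • fderiv ℝ (fun y => g y i) xbar +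
      ∑ j, lam j • fderiv ℝ (fun y => h y j) xbar = 0) ∧
  (∀ i, 0 ≤ μ i) ∧ (∑ i, μ i * g xbar i = 0)

/-- The quadratic form `d ↦ dᵀ ∇²φ(x) d` of the Hessian of `φ` at `x`. -/
noncomputable def hessQuad {n : ℕ} (φ : (Fin n → ℝ) → ℝ) (x d : Fin n → ℝ) : ℝ :=
  fderiv ℝ (fun y => fderiv ℝ φ y d) x d

/-- Row rank equals column rank for a finite family of continuous linear functionals. -/
lemma finrank_range_pi_eq_finrank_span {E ι : Type*} [NormedAddCommGroup E] [NormedSpace ℝ E]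
    [FiniteDimensional ℝ E] [Fintype ι] (φ : ι → E →L[ℝ] ℝ) :
    Module.finrank ℝ (ContinuousLinearMap.pi φ : E →ₗ[ℝ] ι → ℝ).range =
      Module.finrank ℝ (Submodule.span ℝ (Set.range φ)) := by
  set Φ : Submodule ℝ (Module.Dual ℝ E) :=
    (Submodule.span ℝ (Set.range φ)).map (ContinuousLinearMap.coeLM ℝ) with hΦ
  have hdim : Module.finrank ℝ (Submodule.span ℝ (Set.range φ)) = Module.finrank ℝ Φ :=
    (Submodule.equivMapOfInjective _
      (fun _ _ hab ↦ ContinuousLinearMap.coe_injective hab) _).finrank_eq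
  have hker : (ContinuousLinearMap.pi φ : E →ₗ[ℝ] ι → ℝ).ker = Φ.dualCoannihilator := by
    rw [hΦ, Submodule.map_span, ← Set.range_comp]
    refine le_antisymm ?_ fun x hx ↦ ?_
    · rw [← Submodule.le_dualAnnihilator_iff_le_dualCoannihilator, Submodule.span_le]
      rintro _ ⟨k, rfl⟩
      rw [SetLike.mem_coe, Submodule.mem_dualAnnihilator]
      exact fun x hx ↦ congrFun hx k
    · rw [LinearMap.mem_ker]
      funext k
      exact (Submodule.mem_dualCoannihilator _).1 hx _ (Submodule.subset_span ⟨k, rfl⟩)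
  have h₁ := LinearMap.finrank_range_add_finrank_ker
    (ContinuousLinearMap.pi φ : E →ₗ[ℝ] ι → ℝ)
  have h₂ := Subspace.finrank_add_finrank_dualCoannihilator_eq Φ
  rw [hker] at h₁
  omega

/-- Every linear map between vector spaces has a generalized inverse. -/
lemma LinearMap.exists_generalizedInverse {K V W : Type*} [Field K] [AddCommGroup V]
    [AddCommGroup W] [Module K V] [Module K W] (A : V →ₗ[K] W) :
    ∃ B : W →ₗ[K] V, ∀ v, A (B (A v)) = A v := by
  obtain ⟨B₀, hB₀⟩ := A.rangeRestrict.exists_rightInverse_of_surjective A.range_rangeRestrict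
  obtain ⟨B, hB⟩ := B₀.exists_extend
  refine ⟨B, fun v ↦ ?_⟩
  have h₁ : B (A v) = B₀ (A.rangeRestrict v) := LinearMap.congr_fun hB (A.rangeRestrict v)
  have h₂ := LinearMap.congr_fun hB₀ (A.rangeRestrict v)
  rw [h₁]
  exact congrArg Subtype.val h₂

/-- If `A` has the generalized inverse `B` and `T x` has constant rank near `x₀`, with `T x₀ = A`,
then `A * B` is injective on the range of `T x` for `x` near `x₀`. -/
lemma eventually_ker_comp_le_ker {X E F : Type*} [TopologicalSpace X] [NormedAddCommGroup E]
    [NormedSpace ℝ E] [FiniteDimensional ℝ E] [NormedAddCommGroup F] [NormedSpace ℝ F]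
    {T : X → E →L[ℝ] F} {x₀ : X} (hT : ContinuousAt T x₀) {r : ℕ}
    (hr : ∀ᶠ x in 𝓝 x₀, Module.finrank ℝ (T x : E →ₗ[ℝ] F).range = r) {B : F →L[ℝ] E}
    (hB : ∀ v, T x₀ (B (T x₀ v)) = T x₀ v) :
    ∀ᶠ x in 𝓝 x₀, ∀ v, T x₀ (B (T x v)) = 0 → T x v = 0 := by
  set P : F →L[ℝ] F := T x₀ ∘L B
  have hcont : ContinuousAt (fun x ↦ P ∘L T x) x₀ := continuousAt_const.clm_comp hT
  have hP : P ∘L T x₀ = T x₀ := ContinuousLinearMap.ext hB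
  have hmem : P ∘L T x₀ ∈ {S : E →L[ℝ] F | (r : Cardinal) ≤ (S : E →ₗ[ℝ] F).rank} := by
    rw [hP, Set.mem_ofPred_eq, LinearMap.rank, ← Module.finrank_eq_rank, hr.self_of_nhds]
  have hlow := hcont.eventually ((isOpen_setOfPred_nat_le_rank r).mem_nhds hmem)
  filter_upwards [hr, hlow] with x hrx hlx v hv
  rw [LinearMap.rank, ← Module.finrank_eq_rank, Nat.cast_le] at hlx
  have hle : (T x : E →ₗ[ℝ] F).ker ≤ (P ∘L T x : E →L[ℝ] F).toLinearMap.ker := fun w hw ↦ by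
    have hw' : T x w = 0 := hw
    change P (T x w) = 0
    rw [hw', map_zero]
  have h₁ := LinearMap.finrank_range_add_finrank_ker (T x : E →ₗ[ℝ] F)
  have h₂ := LinearMap.finrank_range_add_finrank_ker (P ∘L T x : E →L[ℝ] F).toLinearMap
  have heq := Submodule.eq_of_le_of_finrank_le hle (by omega)
  have hmem : v ∈ (T x : E →ₗ[ℝ] F).ker := heq ▸ hv
  exact hmem

/-- A curve version of the constant rank theorem: if `F'` has constant rank near a zero `x₀` of
`F`, every direction in the kernel of `F' x₀` is tangent to a curve in the zero set of `F`. -/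
lemma exists_curve_of_constant_rank {E F : Type*} [NormedAddCommGroup E] [NormedSpace ℝ E]
    [FiniteDimensional ℝ E] [NormedAddCommGroup F] [NormedSpace ℝ F] [FiniteDimensional ℝ F]
    {G : E → F} (hG : ContDiff ℝ 1 G) {x₀ : E} (h₀ : G x₀ = 0) {r : ℕ}
    (hr : ∀ᶠ x in 𝓝 x₀, Module.finrank ℝ (fderiv ℝ G x : E →ₗ[ℝ] F).range = r)
    {d : E} (hd : fderiv ℝ G x₀ d = 0) :
    ∃ γ : ℝ → E, γ 0 = x₀ ∧ HasDerivAt γ d 0 ∧ ∀ᶠ t in 𝓝 0, G (γ t) = 0 := by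
  set A := fderiv ℝ G x₀
  obtain ⟨B₀, hB₀⟩ := (A : E →ₗ[ℝ] F).exists_generalizedInverse
  set B : F →L[ℝ] E := B₀.toContinuousLinearMap
  have hB : ∀ v, A (B (A v)) = A v := hB₀
  set Φ : E → E := fun x ↦ x + B (G x - A (x - x₀)) with hΦ
  have hΦc : ContDiff ℝ 1 Φ := by fun_prop
  have hΦ₀ : Φ x₀ = x₀ := by simp [hΦ, h₀]
  have hΦd : HasFDerivAt Φ ((ContinuousLinearEquiv.refl ℝ E : E ≃L[ℝ] E) : E →L[ℝ] E) x₀ := by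
    have hGd : HasFDerivAt G A x₀ := (hG.differentiable one_ne_zero x₀).hasFDerivAt
    have h₁ : HasFDerivAt (fun x ↦ A (x - x₀)) A x₀ :=
      A.hasFDerivAt.comp x₀ ((hasFDerivAt_id x₀).sub_const x₀)
    refine ((hasFDerivAt_id x₀).add (B.hasFDerivAt.comp x₀ (hGd.sub h₁))).congr_fderiv ?_
    ext v
    simp
  have hΦs := hΦc.contDiffAt.hasStrictFDerivAt' hΦd one_ne_zero
  set Ψ := hΦc.contDiffAt.localInverse hΦd one_ne_zero
  have hΨc : ContDiffAt ℝ 1 Ψ x₀ := by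
    simpa only [hΦ₀] using hΦc.contDiffAt.to_localInverse hΦd one_ne_zero
  have hΨd : HasFDerivAt Ψ (ContinuousLinearMap.id ℝ E) x₀ := by
    have := hΦs.to_localInverse.hasFDerivAt
    rw [hΦ₀] at this
    exact this
  have hΨ₀ : Ψ x₀ = x₀ := by
    have := hΦs.localInverse_apply_image
    rw [hΦ₀] at this
    exact this
  have hΨr : ∀ᶠ y in 𝓝 x₀, Φ (Ψ y) = y := by
    have := hΦs.eventually_right_inverse
    rw [hΦ₀] at this
    exact this
  have hline : HasDerivAt (fun t : ℝ ↦ x₀ + t • d) d 0 := by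
    simpa using ((hasDerivAt_id (0 : ℝ)).smul_const d).const_add x₀
  have hline₀ : x₀ + (0 : ℝ) • d = x₀ := by simp
  have hlt : Tendsto (fun t : ℝ ↦ x₀ + t • d) (𝓝 0) (𝓝 x₀) := by
    simpa using hline.continuousAt.tendsto
  have hγd : HasDerivAt (fun t : ℝ ↦ Ψ (x₀ + t • d)) d 0 := by
    have h₁ : HasFDerivAt Ψ (ContinuousLinearMap.id ℝ E) (x₀ + (0 : ℝ) • d) := by rwa [hline₀]
    exact h₁.comp_hasDerivAt 0 hline
  have hγt : Tendsto (fun t : ℝ ↦ Ψ (x₀ + t • d)) (𝓝 0) (𝓝 x₀) := by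
    simpa [hΨ₀] using hγd.continuousAt.tendsto
  refine ⟨fun t ↦ Ψ (x₀ + t • d), by simp [hΨ₀], hγd, ?_⟩
  have hker := eventually_ker_comp_le_ker (hG.continuous_fderiv one_ne_zero).continuousAt hr hB
  have hdiff : ∀ᶠ y in 𝓝 x₀, DifferentiableAt ℝ Ψ y :=
    (hΨc.eventually (by simp)).mono fun y hy ↦ hy.differentiableAt one_ne_zero
  have hev : ∀ᶠ t : ℝ in 𝓝 0, HasDerivAt (fun t ↦ G (Ψ (x₀ + t • d))) 0 t := by
    filter_upwards [(hlt.eventually hΨr).eventually_nhds, hlt.eventually hdiff,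
      hγt.eventually hker] with t hrt hdt hkt
    have hl : HasDerivAt (fun t : ℝ ↦ x₀ + t • d) d t := by
      simpa using ((hasDerivAt_id t).smul_const d).const_add x₀
    have h₁ := hdt.hasFDerivAt.comp_hasDerivAt t hl
    have h₂ : HasDerivAt (fun t ↦ G (Ψ (x₀ + t • d)))
        (fderiv ℝ G (Ψ (x₀ + t • d)) (fderiv ℝ Ψ (x₀ + t • d) d)) t :=
      (hG.differentiable one_ne_zero _).hasFDerivAt.comp_hasDerivAt t h₁
    have hzero : ∀ᶠ s in 𝓝 t, A (B (G (Ψ (x₀ + s • d)))) = 0 := by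
      filter_upwards [hrt] with s hs
      have h₃ := congrArg A hs
      simp only [hΦ, map_add, map_sub, hB, map_smul, hd, smul_zero, add_zero] at h₃
      have h₄ : A (B (G (Ψ (x₀ + s • d)))) =
        (A (Ψ (x₀ + s • d)) + (A (B (G (Ψ (x₀ + s • d)))) - (A (Ψ (x₀ + s • d)) - A x₀))) - A x₀ :=
        by abel
      rw [h₄, h₃, sub_self]
    have h₅ := (A ∘L B).hasFDerivAt.comp_hasDerivAt t h₂
    have h₆ := h₅.unique ((hasDerivAt_const t (0 : F)).congr_of_eventuallyEq hzero)
    rwa [hkt _ h₆] at h₂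
  obtain ⟨ε, hε, hball⟩ := Metric.eventually_nhds_iff_ball.1 hev
  filter_upwards [Metric.ball_mem_nhds (0 : ℝ) hε] with t ht
  have := Metric.isOpen_ball.is_const_of_deriv_eq_zero
    (convex_ball (0 : ℝ) ε).isPreconnected
    (fun s hs ↦ (hball s hs).differentiableAt.differentiableWithinAt)
    (fun s hs ↦ (hball s hs).deriv) ht (Metric.mem_ball_self hε)
  rw [this]
  simp [hΨ₀, h₀]

/-- Second-order necessary condition along a curve leaving a critical point. -/
lemma fderiv_fderiv_nonneg_of_curve {E : Type*} [NormedAddCommGroup E] [NormedSpace ℝ E]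
    {L : E → ℝ} (hL : ContDiff ℝ 2 L) {x₀ d : E} (hcrit : fderiv ℝ L x₀ = 0) {γ : ℝ → E}
    (hγ₀ : γ 0 = x₀) (hγ : HasDerivAt γ d 0) (hmin : ∀ᶠ t in 𝓝[>] (0 : ℝ), L x₀ ≤ L (γ t)) :
    0 ≤ fderiv ℝ (fderiv ℝ L) x₀ d d := by
  have hdL : Differentiable ℝ L := hL.differentiable two_ne_zero
  have hmv : ∀ v, ∃ s ∈ Set.Ioo (0 : ℝ) 1, fderiv ℝ L (x₀ + s • v) v = L (x₀ + v) - L x₀ := by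
    intro v
    have hder : ∀ s : ℝ, HasDerivAt (fun s : ℝ ↦ L (x₀ + s • v)) (fderiv ℝ L (x₀ + s • v) v) s :=
      fun s ↦ (hdL _).hasFDerivAt.comp_hasDerivAt s
        (by simpa using ((hasDerivAt_id s).smul_const v).const_add x₀)
    obtain ⟨s, hs, hs'⟩ := exists_hasDerivAt_eq_slope _ _ one_pos
      (fun s _ ↦ (hder s).continuousAt.continuousWithinAt) fun s _ ↦ hder s
    exact ⟨s, hs, by simpa using hs'⟩
  choose s hs hs' using hmv
  set v : ℝ → E := fun t ↦ γ t - x₀ with hv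
  have hvt : Tendsto (fun t : ℝ ↦ t⁻¹ • v t) (𝓝[>] 0) (𝓝 d) := by
    simpa [hv, hγ₀] using hγ.tendsto_slope_zero_right
  have hv₀ : Tendsto v (𝓝[>] 0) (𝓝 0) := by
    have := hγ.continuousAt.tendsto.sub_const x₀
    rw [hγ₀, sub_self] at this
    exact this.mono_left nhdsWithin_le_nhds
  have hsv : Tendsto (fun t ↦ s (v t) • v t) (𝓝[>] 0) (𝓝 0) := by
    refine squeeze_zero_norm (a := fun t ↦ ‖v t‖) (fun t ↦ ?_) (by simpa using hv₀.norm)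
    rw [norm_smul, Real.norm_of_nonneg (hs (v t)).1.le]
    exact mul_le_of_le_one_left (norm_nonneg _) (hs (v t)).2.le
  have hlim := ((hL.fderiv_right (m := 1) le_rfl).differentiable one_ne_zero
    x₀).hasFDerivAt.hasFDerivWithinAt.lim (s := Set.univ) hsv
    (c := fun t ↦ (s (v t) * t)⁻¹) (v := d) (by simp) (hvt.congr' (by
      filter_upwards with t
      rw [smul_smul, mul_inv, mul_right_comm, inv_mul_cancel₀ (hs _).1.ne', one_mul]))
  refine ge_of_tendsto ((isBoundedBilinearMap_apply.continuous.tendsto (_, d)).comp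
    (hlim.prodMk_nhds hvt)) ?_
  filter_upwards [hmin, self_mem_nhdsWithin] with t ht ht₀
  have ht₀ : 0 < t := ht₀
  have h₁ : 0 ≤ fderiv ℝ L (x₀ + s (v t) • v t) (v t) := by
    rw [hs']; simpa [hv] using ht
  simp only [Function.comp_apply, hcrit, sub_zero, smul_apply, map_smul, smul_eq_mul]
  have := (hs (v t)).1
  positivity

lemma hessQuad_eq_fderiv_fderiv {n : ℕ} {φ : (Fin n → ℝ) → ℝ} (hφ : ContDiff ℝ 2 φ)
    (x d : Fin n → ℝ) : hessQuad φ x d = fderiv ℝ (fderiv ℝ φ) x d d := by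
  have h₁ := ((hφ.fderiv_right (m := 1) le_rfl).differentiable one_ne_zero x).hasFDerivAt
  have h₂ := h₁.clm_apply (hasFDerivAt_const d x)
  rw [hessQuad, h₂.fderiv]
  simp

/-- A function that is negative at the start, or vanishes there with negative derivative, is
nonpositive shortly afterwards. -/
lemma eventually_nonpos_right {u : ℝ → ℝ} {u' : ℝ} (hu : HasDerivAt u u' 0)
    (h : u 0 < 0 ∨ (u 0 = 0 ∧ u' < 0)) : ∀ᶠ t in 𝓝[>] (0 : ℝ), u t ≤ 0 := by
  rcases h with h | ⟨h₀, h'⟩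
  · exact ((hu.continuousAt.eventually_lt_const h).filter_mono nhdsWithin_le_nhds).mono
      fun _ ht ↦ ht.le
  · have hlim := hu.tendsto_slope_zero_right
    filter_upwards [hlim.eventually_lt_const h', self_mem_nhdsWithin] with t ht ht₀
    have ht₀ : 0 < t := ht₀
    simp only [zero_add, h₀, sub_zero, smul_eq_mul] at ht
    by_contra! hc
    exact absurd ht (not_lt.2 (by positivity))

/-- Under RCRCQ, every direction of the linearized cone is tangent to a feasible curve along which
the active constraints whose gradient annihilates the direction remain active. -/
lemma RCRCQ.exists_feasible_curve {n m p : ℕ} {g : (Fin n → ℝ) → Fin m → ℝ}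
    {h : (Fin n → ℝ) → Fin p → ℝ} {x₀ : Fin n → ℝ} (hcq : RCRCQ g h x₀)
    (hg : ContDiff ℝ 1 g) (hh : ContDiff ℝ 1 h) (hx₀ : x₀ ∈ feasibleSet g h)
    {d : Fin n → ℝ} (hd : d ∈ linCone g h x₀) :
    ∃ γ : ℝ → Fin n → ℝ, γ 0 = x₀ ∧ HasDerivAt γ d 0 ∧
      ∀ᶠ t in 𝓝[>] (0 : ℝ), γ t ∈ feasibleSet g h ∧
        ∀ i, g x₀ i = 0 → fderiv ℝ (fun y ↦ g y i) x₀ d = 0 → g (γ t) i = 0 := by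
  classical
  have hgi : ∀ i, ContDiff ℝ 1 fun y ↦ g y i := fun i ↦ contDiff_pi.1 hg i
  have hhj : ∀ j, ContDiff ℝ 1 fun y ↦ h y j := fun j ↦ contDiff_pi.1 hh j
  set I : Set (Fin m) := {i | g x₀ i = 0 ∧ fderiv ℝ (fun y ↦ g y i) x₀ d = 0}
  obtain ⟨r, hr⟩ := hcq I fun i hi ↦ hi.1
  set c : I ⊕ Fin p → (Fin n → ℝ) → ℝ := Sum.elim (fun i y ↦ g y i) fun j y ↦ h y j with hc
  have hcd : ∀ k, ContDiff ℝ 1 (c k) := by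
    rintro (i | j)
    exacts [hgi i, hhj j]
  have hfd : ∀ x, fderiv ℝ (fun y k ↦ c k y) x = .pi fun k ↦ fderiv ℝ (c k) x := fun x ↦
    fderiv_pi fun k ↦ (hcd k).differentiable one_ne_zero x
  have hrange : ∀ x, Set.range (fun k ↦ fderiv ℝ (c k) x) =
      (fun i ↦ fderiv ℝ (fun y ↦ g y i) x) '' I ∪
        Set.range fun j ↦ fderiv ℝ (fun y ↦ h y j) x := by
    intro x
    rw [Set.image_eq_range, ← Set.Sum.elim_range]
    congr 1
    funext k
    rcases k with i | j <;> rfl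
  obtain ⟨γ, hγ₀, hγ, hzero⟩ := exists_curve_of_constant_rank (G := fun y k ↦ c k y)
    (contDiff_pi.2 hcd) (x₀ := x₀) (r := r) (d := d)
    (by
      funext k
      rcases k with i | j
      exacts [i.2.1, hx₀.2 j])
    (by
      filter_upwards [hr] with x hx
      rw [hfd, finrank_range_pi_eq_finrank_span, hrange, hx])
    (by
      rw [hfd]
      funext k
      rcases k with i | j
      exacts [i.2.2, hd.2 j])
  have hgγ : ∀ i, HasDerivAt (fun t ↦ g (γ t) i) (fderiv ℝ (fun y ↦ g y i) x₀ d) 0 := by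
    intro i
    have hgd := ((hgi i).differentiable one_ne_zero (γ 0)).hasFDerivAt.comp_hasDerivAt 0 hγ
    rwa [hγ₀] at hgd
  have hneg : ∀ᶠ t in 𝓝[>] (0 : ℝ), ∀ i, i ∉ I → g (γ t) i ≤ 0 := by
    rw [eventually_all]
    intro i
    by_cases hi : i ∈ I
    · exact .of_forall fun _ hi' ↦ absurd hi hi'
    · refine (eventually_nonpos_right (hgγ i) ?_).mono fun _ ht _ ↦ ht
      rw [hγ₀]
      rcases (hx₀.1 i).lt_or_eq with hlt | heq
      · exact .inl hlt
      · exact .inr ⟨heq, lt_of_le_of_ne (hd.1 i heq) fun h₀ ↦ hi ⟨heq, h₀⟩⟩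
  refine ⟨γ, hγ₀, hγ, ?_⟩
  filter_upwards [hzero.filter_mono nhdsWithin_le_nhds, hneg] with t ht hnt
  have hI : ∀ i ∈ I, g (γ t) i = 0 := fun i hi ↦ congrFun ht (.inl ⟨i, hi⟩)
  refine ⟨⟨fun i ↦ ?_, fun j ↦ congrFun ht (.inr j)⟩, fun i h₁ h₂ ↦ hI i ⟨h₁, h₂⟩⟩
  by_cases hi : i ∈ I
  exacts [(hI i hi).le, hnt i hi]

/-- A constraint with nonzero multiplier is active, and its gradient annihilates every strong
critical direction. -/
lemma KKT.active_of_ne_zero {n m p : ℕ} {f : (Fin n → ℝ) → ℝ} {g : (Fin n → ℝ) → Fin m → ℝ}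
    {h : (Fin n → ℝ) → Fin p → ℝ} {x₀ : Fin n → ℝ} {μ : Fin m → ℝ} {lam : Fin p → ℝ}
    (hkkt : KKT f g h x₀ μ lam) (hx₀ : x₀ ∈ feasibleSet g h) {d : Fin n → ℝ}
    (hd : d ∈ linCone g h x₀) (hdf : fderiv ℝ f x₀ d ≤ 0) {i : Fin m} (hi : μ i ≠ 0) :
    g x₀ i = 0 ∧ fderiv ℝ (fun y ↦ g y i) x₀ d = 0 := by
  obtain ⟨hstat, hμ, hcomp⟩ := hkkt
  have hact : ∀ i, μ i * g x₀ i = 0 := fun i ↦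
    (Finset.sum_eq_zero_iff_of_nonpos
      fun i _ ↦ mul_nonpos_of_nonneg_of_nonpos (hμ i) (hx₀.1 i)).1 hcomp i (Finset.mem_univ i)
  have hle : ∀ i, μ i * fderiv ℝ (fun y ↦ g y i) x₀ d ≤ 0 := by
    intro i
    rcases mul_eq_zero.1 (hact i) with h₀ | h₀
    · simp [h₀]
    · exact mul_nonpos_of_nonneg_of_nonpos (hμ i) (hd.1 i h₀)
  have hsum : fderiv ℝ f x₀ d + ∑ i, μ i * fderiv ℝ (fun y ↦ g y i) x₀ d = 0 := by
    simpa [sum_apply, hd.2] using DFunLike.congr_fun hstat d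
  have hsum₀ : ∑ i, μ i * fderiv ℝ (fun y ↦ g y i) x₀ d = 0 :=
    le_antisymm (Finset.sum_nonpos fun i _ ↦ hle i) (by linarith)
  exact ⟨(mul_eq_zero.1 (hact i)).resolve_left hi, (mul_eq_zero.1
    ((Finset.sum_eq_zero_iff_of_nonpos fun i _ ↦ hle i).1 hsum₀ i (Finset.mem_univ i))).resolve_left
      hi⟩

/-- **Theorem (SSONC under RCRCQ).** If `x✶ ∈ Ω` is a local minimizer of `f` over `Ω`
at which RCRCQ holds, then for every multiplier vector `(μ, lam)` satisfying the KKT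
conditions at `x✶` and every `d` in the strong critical cone
`C^S(x✶) = {d ∈ L(x✶) : ∇f(x✶)ᵀd ≤ 0}`, one has `dᵀ ∇²ₓₓ ℓ(x✶, μ, lam) d ≥ 0`. -/
theorem ssonc_of_rcrcq (n m p : ℕ)
    (f : (Fin n → ℝ) → ℝ) (g : (Fin n → ℝ) → Fin m → ℝ) (h : (Fin n → ℝ) → Fin p → ℝ)
    (hf : ContDiff ℝ 2 f) (hg : ContDiff ℝ 2 g) (hh : ContDiff ℝ 2 h)
    (xs : Fin n → ℝ) (hxs : xs ∈ feasibleSet g h)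
    (hmin : IsLocalMinOn f (feasibleSet g h) xs)
    (hcq : RCRCQ g h xs)
    (μ : Fin m → ℝ) (lam : Fin p → ℝ) (hkkt : KKT f g h xs μ lam)
    (d : Fin n → ℝ) (hdL : d ∈ linCone g h xs) (hdf : fderiv ℝ f xs d ≤ 0) :
    0 ≤ hessQuad f xs d + ∑ i, μ i * hessQuad (fun y => g y i) xs d +
        ∑ j, lam j * hessQuad (fun y => h y j) xs d := by
  have hgi : ∀ i, ContDiff ℝ 2 fun y ↦ g y i := fun i ↦ contDiff_pi.1 hg i
  have hhj : ∀ j, ContDiff ℝ 2 fun y ↦ h y j := fun j ↦ contDiff_pi.1 hh j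
  obtain ⟨γ, hγ₀, hγ, hfeas⟩ := hcq.exists_feasible_curve (hg.of_le one_le_two)
    (hh.of_le one_le_two) hxs hdL
  set L : (Fin n → ℝ) → ℝ := fun y ↦ f y + ∑ i, μ i * g y i + ∑ j, lam j * h y j with hLdef
  have hL : ContDiff ℝ 2 L := (hf.add (ContDiff.sum fun i _ ↦ contDiff_const.mul (hgi i))).add
    (ContDiff.sum fun j _ ↦ contDiff_const.mul (hhj j))
  have hfderiv : ∀ y, HasFDerivAt L (fderiv ℝ f y + ∑ i, μ i • fderiv ℝ (fun y ↦ g y i) y +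
      ∑ j, lam j • fderiv ℝ (fun y ↦ h y j) y) y := fun y ↦
    ((hf.differentiable two_ne_zero y).hasFDerivAt.add (HasFDerivAt.fun_sum fun i _ ↦
      ((hgi i).differentiable two_ne_zero y).hasFDerivAt.const_mul (μ i))).add
      (HasFDerivAt.fun_sum fun j _ ↦
        ((hhj j).differentiable two_ne_zero y).hasFDerivAt.const_mul (lam j))
  have hcrit : fderiv ℝ L xs = 0 := (hfderiv xs).fderiv.trans hkkt.1
  have hsecond : ∀ {φ : (Fin n → ℝ) → ℝ}, ContDiff ℝ 2 φ →
      HasFDerivAt (fderiv ℝ φ) (fderiv ℝ (fderiv ℝ φ) xs) xs := fun hφ ↦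
    ((hφ.fderiv_right (m := 1) le_rfl).differentiable one_ne_zero xs).hasFDerivAt
  have hhess : fderiv ℝ (fderiv ℝ L) xs = fderiv ℝ (fderiv ℝ f) xs +
      ∑ i, μ i • fderiv ℝ (fderiv ℝ fun y ↦ g y i) xs +
      ∑ j, lam j • fderiv ℝ (fderiv ℝ fun y ↦ h y j) xs := by
    rw [show fderiv ℝ L = _ from funext fun y ↦ (hfderiv y).fderiv]
    exact (((hsecond hf).add (HasFDerivAt.fun_sum fun i _ ↦
      (hsecond (hgi i)).const_smul (μ i))).add (HasFDerivAt.fun_sum fun j _ ↦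
      (hsecond (hhj j)).const_smul (lam j))).fderiv
  have hγt : Tendsto γ (𝓝[>] 0) (𝓝 xs) := by
    have hct := hγ.continuousAt.tendsto
    rw [hγ₀] at hct
    exact hct.mono_left nhdsWithin_le_nhds
  have hLmin : ∀ᶠ t in 𝓝[>] (0 : ℝ), L xs ≤ L (γ t) := by
    filter_upwards [hfeas, hγt.eventually (eventually_nhdsWithin_iff.1 hmin)] with t ht hft
    have hval : ∀ y ∈ feasibleSet g h, (∀ i, g xs i = 0 → fderiv ℝ (fun y ↦ g y i) xs d = 0 →
        g y i = 0) → L y = f y := by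
      intro y hy hyI
      have hμg : ∀ i, μ i * g y i = 0 := fun i ↦ by
        by_cases hi : μ i = 0
        · rw [hi, zero_mul]
        · obtain ⟨h₁, h₂⟩ := hkkt.active_of_ne_zero hxs hdL hdf hi
          rw [hyI i h₁ h₂, mul_zero]
      simp [hLdef, hμg, hy.2]
    rw [hval xs hxs fun i hi _ ↦ hi, hval _ ht.1 ht.2]
    exact hft ht.1
  have hnonneg := fderiv_fderiv_nonneg_of_curve hL hcrit hγ₀ hγ hLmin
  rw [hessQuad_eq_fderiv_fderiv hf]
  simp only [hessQuad_eq_fderiv_fderiv (hgi _), hessQuad_eq_fderiv_fderiv (hhj _)]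
  simpa [hhess, sum_apply] using hnonneg
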